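/- With the admissible system of neighborhoods Vᵢ^l and the triangle data (c₁,c₂,c₃,ε₀,α₀) as in the context, there exist L₀ ≥ l₀ and δ₀ > 0 such that for every l ≥ L₀, every ρ ∈ ℂ with |ρ| = 1−α₀, and every polynomial skew product g(z,w) = (h(z,w), q^{m₁·l}(w)) satisfying |h(z,w) − (ρz + ε₀cⱼ)| ≤ δ₀ for all (z,w) ∈ 2𝔻 × Vⱼ^l and j ∈ {1,2,3}, the following hold: (a) closure(∪_{j=1}^3 𝔻 × Vⱼ^l) ⊆ g(∪_{j=1}^3 𝔻 × Vⱼ^l); (b) |∂h/∂z(z,w)| < 1 for all (z,w) ∈ closure(𝔻 × Vⱼ^l) and each j; consequently Λ_g := ∩_{n≥0} g^{-n}(closure(∪_{j=1}^3 𝔻 × Vⱼ^l)) is a nonempty compact set. -/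

import Mathlib

open Metric Set

/-- An admissible system of shrinking neighborhoods around three repelling periodic points of a
polynomial `q`, as provided by Lemma 3.1 of the paper. -/
structure AdmissibleSystem where
  /-- the degree -/
  d : ℕ
  hd : 2 ≤ d
  /-- the polynomial -/
  q : Polynomial ℂ
  hq : q.natDegree = d
  /-- the period -/
  m₁ : ℕ
  hm₁ : 1 ≤ m₁
  /-- the three repelling periodic points -/
  r : Fin 3 → ℂ
  hr : Function.Injective r
  hper : ∀ i, (fun w => q.eval w)^[m₁] (r i) = r i
  hrep : ∀ i, 1 < ‖deriv ((fun w => q.eval w)^[m₁]) (r i)‖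
  hpc : ∀ i, r i ∉ ⋃ n : ℕ, (fun w => q.eval w)^[n + 1] '' {w : ℂ | q.derivative.eval w = 0}
  /-- the expansion constant -/
  A : ℝ
  hA : 0 < A
  /-- the threshold index -/
  l₀ : ℕ
  hl₀ : 1 ≤ l₀
  /-- constants controlling the diameters -/
  a₁ : ℝ
  ha₁ : 0 < a₁
  a₂ : ℝ
  ha₂ : 0 < a₂
  ha₂' : a₂ < 1
  /-- the neighborhoods -/
  V : Fin 3 → ℕ → Set ℂ
  hVopen : ∀ i l, IsOpen (V i l)
  hVconn : ∀ i l, IsConnected (V i l)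
  hVmem : ∀ i l, r i ∈ V i l
  hVmap : ∀ i l, (fun w => q.eval w)^[m₁] '' V i (l + 1) = V i l
  hVdiam : ∀ i l, EMetric.diam (V i l) ≤ ENNReal.ofReal (a₁ * a₂ ^ l)
  hVexp : ∀ l, l₀ ≤ l → ∀ i, ∀ w ∈ V i l,
    A * ‖deriv ((fun w => q.eval w)^[m₁]) (r i)‖ ^ l ≤
      ‖deriv ((fun w => q.eval w)^[l * m₁]) w‖
  hVexp1 : ∀ l, l₀ ≤ l → ∀ i, 1 < A * ‖deriv ((fun w => q.eval w)^[m₁]) (r i)‖ ^ l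
  hVcover : ∀ l, l₀ ≤ l → ∀ i,
    closure (V 0 l ∪ V 1 l ∪ V 2 l) ⊆ (fun w => q.eval w)^[l * m₁] '' V i l
  hVbij : ∀ l, l₀ ≤ l → ∀ i j, Set.BijOn ((fun w => q.eval w)^[l * m₁])
    (V i l ∩ (fun w => q.eval w)^[l * m₁] ⁻¹' V j l) (V j l)


lemma aux_diff (P : MvPolynomial (Fin 2) ℂ) (w : ℂ) :
    Differentiable ℂ (fun z => MvPolynomial.eval ![z, w] P) := by
  induction P using MvPolynomial.induction_on with
  | C a => simp
  | add p q hp hq => simp only [map_add]; exact hp.add hq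
  | mul_X p i hp =>
    simp only [map_mul, MvPolynomial.eval_X]
    refine hp.mul ?_
    fin_cases i
    · simp
    · simp

lemma aux_cont (P : MvPolynomial (Fin 2) ℂ) :
    Continuous (fun x : ℂ × ℂ => MvPolynomial.eval ![x.1, x.2] P) := by
  refine (MvPolynomial.continuous_eval P).comp (continuous_pi fun i => ?_)
  fin_cases i
  · exact continuous_fst
  · exact continuous_snd

lemma aux_cont2 (P : MvPolynomial (Fin 2) ℂ) (z : ℂ) :
    Continuous (fun w : ℂ => MvPolynomial.eval ![z, w] P) := by
  refine (MvPolynomial.continuous_eval P).comp (continuous_pi fun i => ?_)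
  fin_cases i
  · exact continuous_const
  · exact continuous_id

lemma aux_deriv (f : ℂ → ℂ) (hf : Differentiable ℂ f) (ρ a : ℂ) (δ : ℝ)
    (h : ∀ z ∈ ball (0:ℂ) 2, ‖f z - (ρ * z + a)‖ ≤ δ) (z : ℂ) (hz : z ∈ closedBall (0:ℂ) 1) :
    ‖deriv (fun z => f z - (ρ * z + a)) z‖ ≤ δ ∧ deriv (fun z => f z - (ρ * z + a)) z = deriv f z - ρ := by
  have hd : Differentiable ℂ (fun z => f z - (ρ * z + a)) := by fun_prop
  constructor
  · have h2 : ∀ z ∈ closedBall (0:ℂ) 2, ‖f z - (ρ * z + a)‖ ≤ δ := by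
      have hcl : IsClosed {z | ‖f z - (ρ * z + a)‖ ≤ δ} :=
        isClosed_le hd.continuous.norm continuous_const
      intro z hz
      rw [← closure_ball (0:ℂ) (by norm_num : (2:ℝ) ≠ 0)] at hz
      exact hcl.closure_subset_iff.2 h hz
    have := Complex.norm_deriv_le_of_forall_mem_sphere_norm_le (c := z) (R := 1) (C := δ)
      one_pos hd.diffContOnCl (by
        intro u hu
        apply h2
        rw [mem_sphere_iff_norm] at hu
        rw [mem_closedBall_zero_iff] at hz ⊢
        have : u = (u - z) + z := by ring
        rw [this]
        linarith [norm_add_le (u - z) z])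
    simpa using this
  · have := ((hf z).hasDerivAt.sub (((hasDerivAt_id z).const_mul ρ).add_const a)).deriv
    simp only [mul_one] at this
    exact this

lemma aux_solve (f : ℂ → ℂ) (hf : Differentiable ℂ f) (ρ a z0 : ℂ) (δ M : ℝ) (hδ : 0 < δ)
    (h : ∀ z ∈ ball (0:ℂ) 2, ‖f z - (ρ * z + a)‖ ≤ δ) (hz0 : ‖z0 - a‖ ≤ M)
    (hM : M + δ < ‖ρ‖) : ∃ z ∈ ball (0:ℂ) 1, f z = z0 := by
  have hM0 : 0 ≤ M := (norm_nonneg _).trans hz0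
  have hρ : 0 < ‖ρ‖ := by linarith
  have hρ0 : ρ ≠ 0 := norm_pos_iff.1 hρ
  set e : ℂ → ℂ := fun z => f z - (ρ * z + a) with he
  have hed : Differentiable ℂ e := by fun_prop
  let T : ℂ → ℂ := fun z => (z0 - a - e z) / ρ
  have hTb : ∀ z ∈ closedBall (0:ℂ) 1, T z ∈ ball (0:ℂ) 1 := by
    intro z hz
    rw [mem_ball_zero_iff, norm_div, div_lt_one hρ]
    have := h z (closedBall_subset_ball (by norm_num) hz)
    have h3 := norm_sub_le (z0 - a) (e z)
    simp only [he] at h3 ⊢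
    linarith
  have hmaps : MapsTo T (closedBall 0 1) (closedBall 0 1) := fun z hz =>
    ball_subset_closedBall (hTb z hz)
  have hlip : ∀ x ∈ closedBall (0:ℂ) 1, ∀ y ∈ closedBall (0:ℂ) 1, ‖e y - e x‖ ≤ δ * ‖y - x‖ := by
    intro x hx y hy
    exact (convex_closedBall (0:ℂ) 1).norm_image_sub_le_of_norm_deriv_le
      (fun z _ => hed z) (fun z hz => (aux_deriv f hf ρ a δ h z hz).1) hx hy
  let K : NNReal := ⟨δ / ‖ρ‖, by positivity⟩
  have hK : ContractingWith K (hmaps.restrict T _ _) := by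
    refine ⟨?_, ?_⟩
    · rw [← NNReal.coe_lt_coe]
      show δ / ‖ρ‖ < 1
      rw [div_lt_one hρ]; linarith
    · refine LipschitzWith.of_dist_le_mul ?_
      rintro ⟨x, hx⟩ ⟨y, hy⟩
      show dist (T x) (T y) ≤ δ / ‖ρ‖ * dist x y
      rw [dist_eq_norm, dist_eq_norm]
      have : T x - T y = (e y - e x) / ρ := by simp only [T]; field_simp; ring
      rw [this, norm_div, div_mul_eq_mul_div, norm_sub_rev x y]
      gcongr
      exact hlip x hx y hy
  obtain ⟨z, hz, hfix, -⟩ := hK.exists_fixedPoint' isClosed_closedBall.isComplete hmaps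
    (mem_closedBall_self zero_le_one) (edist_ne_top _ _)
  have hz1 : T z = z := hfix
  refine ⟨z, hz1 ▸ hTb z hz, ?_⟩
  simp only [T, he] at hz1
  rw [div_eq_iff hρ0] at hz1
  linear_combination -hz1

lemma aux_M (b : Fin 3 → ℂ) (s : ℝ) (hs : 0 ≤ s)
    (h : closure (ball (0:ℂ) 1) ⊆ ⋃ j : Fin 3, (fun z => (s:ℂ) * z + b j) '' ball 0 1) :
    ∃ M < s, ∀ z ∈ closedBall (0:ℂ) 1, ∃ j, ‖z - b j‖ ≤ M := by
  rw [closure_ball (0:ℂ) one_ne_zero] at h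
  have hs' : 0 < s := by
    rcases hs.lt_or_eq with h0 | h0
    · exact h0
    · exfalso
      subst h0
      have : closedBall (0:ℂ) 1 ⊆ range b := by
        intro z hz
        obtain ⟨j, u, -, hu⟩ := mem_iUnion.1 (h hz)
        exact ⟨j, by simpa using hu⟩
      exact infinite_of_mem_nhds (0:ℂ) (closedBall_mem_nhds 0 one_pos)
        ((finite_range b).subset this)
  have hc : Continuous (fun z => min ‖z - b 0‖ (min ‖z - b 1‖ ‖z - b 2‖)) := by fun_prop
  obtain ⟨z0, hz0, hmax⟩ := (isCompact_closedBall (0:ℂ) 1).exists_isMaxOn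
    ⟨0, mem_closedBall_self zero_le_one⟩ hc.continuousOn
  refine ⟨min ‖z0 - b 0‖ (min ‖z0 - b 1‖ ‖z0 - b 2‖), ?_, fun z hz => ?_⟩
  · obtain ⟨j, u, hu, huz⟩ := mem_iUnion.1 (h hz0)
    have : ‖z0 - b j‖ < s := by
      rw [← huz]
      simp only [add_sub_cancel_right, norm_mul, Complex.norm_real, Real.norm_eq_abs, abs_of_pos hs']
      rw [mem_ball_zero_iff] at hu
      nlinarith
    fin_cases j
    · exact (min_le_left _ _).trans_lt this
    · exact ((min_le_right _ _).trans (min_le_left _ _)).trans_lt this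
    · exact ((min_le_right _ _).trans (min_le_right _ _)).trans_lt this
  · have := hmax hz
    simp only [mem_setOf_eq] at this
    rcases min_choice ‖z - b 0‖ (min ‖z - b 1‖ ‖z - b 2‖) with h1 | h1
    · exact ⟨0, h1 ▸ this⟩
    · rcases min_choice ‖z - b 1‖ ‖z - b 2‖ with h2 | h2
      · exact ⟨1, by rw [h1, h2] at this; exact this⟩
      · exact ⟨2, by rw [h1, h2] at this; exact this⟩

lemma aux_inv {X : Type*} [TopologicalSpace X] [T2Space X] (g : X → X) (hg : Continuous g)
    (K : Set X) (hK : IsCompact K) (hne : K.Nonempty) (hsub : K ⊆ g '' K) :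
    IsCompact (⋂ n : ℕ, g^[n] ⁻¹' K) ∧ (⋂ n : ℕ, g^[n] ⁻¹' K).Nonempty := by
  have hcl : ∀ n, IsClosed (g^[n] ⁻¹' K) := fun n => hK.isClosed.preimage (hg.iterate n)
  refine ⟨hK.of_isClosed_subset (isClosed_iInter hcl) (fun x hx => mem_iInter.1 hx 0), ?_⟩
  have hback : ∀ n : ℕ, ∀ x ∈ K, ∃ y, ∀ k ≤ n, g^[k] y ∈ K ∧ g^[n] y = x := by
    intro n
    induction n with
    | zero => intro x hx; exact ⟨x, fun k hk => by simp_all⟩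
    | succ n ih =>
      intro x hx
      obtain ⟨u, hu, rfl⟩ := hsub hx
      obtain ⟨y, hy⟩ := ih u hu
      refine ⟨y, fun k hk => ?_⟩
      have h1 : g^[n+1] y = g u := by
        rw [Function.iterate_succ_apply', (hy n le_rfl).2]
      refine ⟨?_, h1⟩
      rcases Nat.le_succ_iff.1 hk with h | h
      · exact (hy k h).1
      · subst h; rw [Nat.succ_eq_add_one, h1]; exact hx
  have := IsCompact.nonempty_iInter_of_sequence_nonempty_isCompact_isClosed
    (fun n : ℕ => ⋂ k : ℕ, ⋂ _ : k ≤ n, g^[k] ⁻¹' K)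
    (fun n x hx => by
      simp only [mem_iInter] at hx ⊢
      exact fun k hk => hx k (by omega))
    (fun n => by
      obtain ⟨x, hx⟩ := hne
      obtain ⟨y, hy⟩ := hback n x hx
      exact ⟨y, by simp only [mem_iInter]; exact fun k hk => (hy k hk).1⟩)
    (hK.of_isClosed_subset (isClosed_iInter fun k => isClosed_iInter fun _ => hcl k)
      (fun x hx => by simp only [mem_iInter] at hx; exact hx 0 le_rfl))
    (fun n => isClosed_iInter fun k => isClosed_iInter fun _ => hcl k)
  obtain ⟨x, hx⟩ := this
  refine ⟨x, ?_⟩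
  simp only [mem_iInter] at hx ⊢
  exact fun k => hx k k le_rfl

set_option maxHeartbeats 1000000 in
/-- Proposition 3.8: given an admissible system and triangle data `(c, ε₀, α₀)` as in Lemma 3.2,
there are `L₀ ≥ l₀` and `δ₀ > 0` such that for `l ≥ L₀`, `|ρ| = 1 - α₀`, any polynomial skew
product `g = (h, q^{m₁ l})` with `h` δ₀-close to `ρ z + ε₀ cⱼ` on `2𝔻 × Vⱼ^l` satisfies the
covering property (a) and the horizontal contraction (b); consequently the saddle blender
`Λ_g = ⋂ₙ g^{-n}(closure (⋃ⱼ 𝔻 × Vⱼ^l))` is a nonempty compact set. -/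
theorem stmt_6 (S : AdmissibleSystem) (c : Fin 3 → ℂ)
    (hc : ¬ Collinear ℝ ({c 0, c 1, c 2} : Set ℂ)) (hcsum : c 0 + c 1 + c 2 = 0)
    (ε₀ α₀ : ℝ) (hε₀ : 0 < ε₀) (hα₀ : 0 < α₀)
    (htri : ∀ ρ : ℂ, 1 - α₀ ≤ ‖ρ‖ → ‖ρ‖ ≤ 1 + α₀ →
      (closure (ball (0:ℂ) 1) ⊆ ⋃ j : Fin 3, (fun z => ρ * z + (ε₀ : ℂ) * c j) '' ball 0 1) ∧
      ∃ H : Fin 3 → Set ℂ, (∀ j, IsOpen (H j)) ∧ (∀ j, ball (0:ℂ) (1/2) ⊆ H j) ∧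
        (∀ j, H j ⊆ ball (0:ℂ) 1) ∧ ball (0:ℂ) 1 = H 0 ∪ H 1 ∪ H 2 ∧
        (∀ j, closure ((fun z => ρ * z + (ε₀ : ℂ) * c j) '' H j) ⊆ ball 0 1)) :
    ∃ (L₀ : ℕ) (δ₀ : ℝ), S.l₀ ≤ L₀ ∧ 0 < δ₀ ∧
      ∀ l, L₀ ≤ l → ∀ ρ : ℂ, ‖ρ‖ = 1 - α₀ →
        ∀ P : MvPolynomial (Fin 2) ℂ,
          (∀ j : Fin 3, ∀ x ∈ ball (0:ℂ) 2 ×ˢ S.V j l,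
            ‖MvPolynomial.eval ![x.1, x.2] P - (ρ * x.1 + (ε₀ : ℂ) * c j)‖ ≤ δ₀) →
          (closure (⋃ j : Fin 3, ball (0:ℂ) 1 ×ˢ S.V j l) ⊆
            (fun x : ℂ × ℂ =>
                (MvPolynomial.eval ![x.1, x.2] P, (fun w => S.q.eval w)^[S.m₁ * l] x.2)) ''
              (⋃ j : Fin 3, ball (0:ℂ) 1 ×ˢ S.V j l)) ∧
          (∀ j : Fin 3, ∀ x ∈ closure (ball (0:ℂ) 1 ×ˢ S.V j l),
            ‖deriv (fun z => MvPolynomial.eval ![z, x.2] P) x.1‖ < 1) ∧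
          IsCompact (⋂ n : ℕ,
            (fun x : ℂ × ℂ =>
                (MvPolynomial.eval ![x.1, x.2] P, (fun w => S.q.eval w)^[S.m₁ * l] x.2))^[n] ⁻¹'
              closure (⋃ j : Fin 3, ball (0:ℂ) 1 ×ˢ S.V j l)) ∧
          (⋂ n : ℕ,
            (fun x : ℂ × ℂ =>
                (MvPolynomial.eval ![x.1, x.2] P, (fun w => S.q.eval w)^[S.m₁ * l] x.2))^[n] ⁻¹'
              closure (⋃ j : Fin 3, ball (0:ℂ) 1 ×ˢ S.V j l)).Nonempty := by
  by_cases hs : 0 ≤ 1 - α₀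
  swap
  · refine ⟨S.l₀, 1, le_rfl, one_pos, ?_⟩
    intro l _ ρ hρ
    exact absurd (hρ ▸ norm_nonneg ρ) hs
  have hn : ‖((1 - α₀ : ℝ) : ℂ)‖ = 1 - α₀ := by
    rw [Complex.norm_real, Real.norm_eq_abs, abs_of_nonneg hs]
  obtain ⟨M, hM, hMz⟩ := aux_M (fun j => (ε₀ : ℂ) * c j) (1 - α₀) hs
    (htri ((1 - α₀ : ℝ) : ℂ) hn.ge (by rw [hn]; linarith)).1
  refine ⟨S.l₀, min (α₀ / 2) ((1 - α₀ - M) / 2), le_rfl, lt_min (by linarith) (by linarith), ?_⟩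
  set δ := min (α₀ / 2) ((1 - α₀ - M) / 2) with hδdef
  have hδ : 0 < δ := lt_min (by linarith) (by linarith)
  have hδ1 : δ ≤ α₀ / 2 := min_le_left _ _
  have hδ2 : δ ≤ (1 - α₀ - M) / 2 := min_le_right _ _
  intro l hl ρ hρ P hP
  have hqc : Continuous (fun w => S.q.eval w)^[S.m₁ * l] := S.q.continuous.iterate _
  have hUK : closure (⋃ j : Fin 3, ball (0:ℂ) 1 ×ˢ S.V j l)
      = ⋃ j : Fin 3, closedBall (0:ℂ) 1 ×ˢ closure (S.V j l) := by
    rw [closure_iUnion_of_finite]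
    simp only [closure_prod_eq, closure_ball (0:ℂ) one_ne_zero]
  have ha : closure (⋃ j : Fin 3, ball (0:ℂ) 1 ×ˢ S.V j l) ⊆
            (fun x : ℂ × ℂ =>
                (MvPolynomial.eval ![x.1, x.2] P, (fun w => S.q.eval w)^[S.m₁ * l] x.2)) ''
              (⋃ j : Fin 3, ball (0:ℂ) 1 ×ˢ S.V j l) := by
    rw [hUK]
    rintro ⟨z0, w0⟩ hx
    obtain ⟨i, hz0, hw0⟩ := mem_iUnion.1 hx
    obtain ⟨j, hj⟩ := hMz z0 hz0
    have hw1 : w0 ∈ closure (S.V 0 l ∪ S.V 1 l ∪ S.V 2 l) := by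
      refine closure_mono ?_ hw0
      intro u hu
      fin_cases i
      · exact Or.inl (Or.inl hu)
      · exact Or.inl (Or.inr hu)
      · exact Or.inr hu
    obtain ⟨w, hw, hww⟩ := S.hVcover l hl j hw1
    obtain ⟨z, hz, hzz⟩ := aux_solve (fun z => MvPolynomial.eval ![z, w] P) (aux_diff P w) ρ
      ((ε₀ : ℂ) * c j) z0 δ M hδ (fun z hz => hP j (z, w) ⟨hz, hw⟩) hj (by rw [hρ]; linarith)
    refine ⟨(z, w), mem_iUnion.2 ⟨j, hz, hw⟩, ?_⟩
    rw [mul_comm] at hww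
    exact Prod.ext hzz hww
  refine ⟨ha, ?_, ?_⟩
  · intro j x hx
    rw [closure_prod_eq, closure_ball (0:ℂ) one_ne_zero] at hx
    have hcl : ∀ z ∈ ball (0:ℂ) 2,
        ‖MvPolynomial.eval ![z, x.2] P - (ρ * z + (ε₀ : ℂ) * c j)‖ ≤ δ := by
      intro z hz
      have hc1 : Continuous fun w => MvPolynomial.eval ![z, w] P :=
        aux_cont2 P z
      have : IsClosed {w | ‖MvPolynomial.eval ![z, w] P - (ρ * z + (ε₀ : ℂ) * c j)‖ ≤ δ} :=
        isClosed_le (hc1.sub continuous_const).norm continuous_const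
      have hsub : S.V j l ⊆ {w | ‖MvPolynomial.eval ![z, w] P - (ρ * z + (ε₀ : ℂ) * c j)‖ ≤ δ} :=
        fun w hw => hP j (z, w) (mk_mem_prod hz hw)
      exact closure_minimal hsub this hx.2
    obtain ⟨h1, h2⟩ := aux_deriv _ (aux_diff P x.2) ρ _ δ hcl x.1 hx.1
    rw [h2] at h1
    have h3 := norm_add_le (deriv (fun z => MvPolynomial.eval ![z, x.2] P) x.1 - ρ) ρ
    rw [sub_add_cancel] at h3
    linarith
  · refine aux_inv _ ((aux_cont P).prodMk (hqc.comp continuous_snd)) _ ?_ ?_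
      (ha.trans (image_mono subset_closure))
    · rw [hUK]
      refine isCompact_iUnion fun j => (isCompact_closedBall _ _).prod ?_
      refine Bornology.IsBounded.isCompact_closure ?_
      rw [isBounded_iff_ediam_ne_top]
      exact ne_top_of_le_ne_top ENNReal.ofReal_ne_top (S.hVdiam j l)
    · exact ⟨(0, S.r 0), subset_closure (mem_iUnion.2 ⟨0, mem_ball_self one_pos, S.hVmem 0 l⟩)⟩
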